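/- Let a ≥ 0 and b ≥ 0 be integers, let n = 2^a(2b+1) and k = 2^{a+1} − 1. Let α₁, …, α_k be real-valued functions on the space of convex bodies of the Euclidean space ℝ^{2n}, each continuous with respect to the Hausdorff metric. Then for every convex body C ⊆ ℝ^{2n} containing the origin in its interior there exists a linear subspace V ⊆ ℝ^{2n} with dim V = n such that for every 1 ≤ i ≤ k, the value of α_i on the convex body C ∩ V equals the value of α_i on the convex body C ∩ V^⊥, where V^⊥ is the orthogonal complement of V. -/

import Mathlib

/-- The intersection of a convex body containing `0` with a linear subspace is a convex
body (nonempty since it contains `0`, compact and convex). -/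
noncomputable def ConvexBody.interSubmodule {d : ℕ}
    (C : ConvexBody (EuclideanSpace ℝ (Fin d)))
    (V : Submodule ℝ (EuclideanSpace ℝ (Fin d)))
    (h0 : (0 : EuclideanSpace ℝ (Fin d)) ∈ (C : Set (EuclideanSpace ℝ (Fin d)))) :
    ConvexBody (EuclideanSpace ℝ (Fin d)) :=
  ⟨(C : Set (EuclideanSpace ℝ (Fin d))) ∩ (V : Set (EuclideanSpace ℝ (Fin d))),
    C.convex.inter V.convex,
    C.isCompact.inter_right V.closed_of_finiteDimensional,
    ⟨0, h0, V.zero_mem⟩⟩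

open Matrix Kronecker

/-- A finite model, with coefficients in `ZMod 2`, of the quotient of a space `X` by an
involution `T`, at scale `ε`. The cells are lifted to points of `X`; `boundary` is the incidence
matrix and `twist` is the part of it that changes sheets of the double cover. The last algebraic
field says that the `N`-th power of the class of the double cover evaluates to `1`. -/
structure TwistedComplex (X : Type*) [PseudoMetricSpace X] (T : X → X) (N : ℕ) (ε : ℝ) where
  /-- the cells -/
  Cell : Type
  [fintype : Fintype Cell]
  [decEq : DecidableEq Cell]
  /-- the incidence matrix of the quotient -/
  boundary : Matrix Cell Cell (ZMod 2)
  /-- the incidences between different sheets -/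
  twist : Matrix Cell Cell (ZMod 2)
  /-- the sum of the cells of top dimension -/
  top : Cell → ZMod 2
  /-- the sum of the vertices -/
  bot : Cell → ZMod 2
  /-- the lift of a cell to a point of the space -/
  point : Cell → X
  boundary_mul_self : boundary * boundary = 0
  commute : Commute boundary twist
  transpose_mulVec_top : boundaryᵀ *ᵥ top = 0
  mulVec_bot : boundary *ᵥ bot = 0
  top_twist_pow_bot : ∀ i, top ⬝ᵥ (twist ^ i *ᵥ bot) = if i = N then 1 else 0
  dist_of_untwisted : ∀ b c, (boundary + twist) b c ≠ 0 → dist (point b) (point c) < ε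
  dist_of_twisted : ∀ b c, twist b c ≠ 0 → dist (point b) (T (point c)) < ε

namespace TwistedComplex

attribute [instance] fintype decEq

variable {X : Type*} [PseudoMetricSpace X] {T : X → X} {N : ℕ} {ε : ℝ}

/-- The coboundary of the function on the double cover that is odd and is given by `s` on the
chosen lifts. -/
def oddCoboundary (K : TwistedComplex X T N ε) (s : K.Cell → ZMod 2) :
    Matrix K.Cell K.Cell (ZMod 2) :=
  K.boundary * diagonal s + diagonal s * K.boundary + K.twist

/-- Successive application of the coboundaries of odd functions to the sum of the vertices. -/
def cupBot (K : TwistedComplex X T N ε) (s : ℕ → K.Cell → ZMod 2) : ℕ → K.Cell → ZMod 2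
  | 0 => K.bot
  | i + 1 => K.oddCoboundary (s i) *ᵥ K.cupBot s i

theorem cupBot_closed_and_cohomologous (K : TwistedComplex X T N ε)
    (s : ℕ → K.Cell → ZMod 2) (i : ℕ) :
    K.boundary *ᵥ K.cupBot s i = 0 ∧
      ∃ u, K.cupBot s i = K.twist ^ i *ᵥ K.bot + K.boundary *ᵥ u := by
  induction i with
  | zero => exact ⟨K.mulVec_bot, 0, by simp [cupBot]⟩
  | succ i ih =>
    obtain ⟨h0, u, hu⟩ := ih
    have key : K.cupBot s (i + 1) =
        K.boundary *ᵥ (diagonal (s i) *ᵥ K.cupBot s i) + K.twist *ᵥ K.cupBot s i := by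
      rw [cupBot, oddCoboundary, add_mulVec, add_mulVec, ← mulVec_mulVec, ← mulVec_mulVec, h0]
      simp
    have hc (v : K.Cell → ZMod 2) :
        K.boundary *ᵥ (K.twist *ᵥ v) = K.twist *ᵥ (K.boundary *ᵥ v) := by
      rw [mulVec_mulVec, K.commute.eq, ← mulVec_mulVec]
    have hsq (v : K.Cell → ZMod 2) : K.boundary *ᵥ (K.boundary *ᵥ v) = 0 := by
      rw [mulVec_mulVec, K.boundary_mul_self, zero_mulVec]
    refine ⟨?_, diagonal (s i) *ᵥ K.cupBot s i + K.twist *ᵥ u, ?_⟩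
    · rw [key, mulVec_add, hsq, hc, h0, mulVec_zero, add_zero]
    · rw [key]
      conv_lhs => enter [2]; rw [hu]
      rw [mulVec_add, mulVec_add, hc, pow_succ', ← mulVec_mulVec _ K.twist]
      abel

theorem exists_cupBot_ne_zero (K : TwistedComplex X T N ε) (s : ℕ → K.Cell → ZMod 2) :
    ∃ b, K.cupBot s N b ≠ 0 := by
  by_contra! h
  obtain ⟨-, u, hu⟩ := K.cupBot_closed_and_cohomologous s N
  have h1 : K.top ⬝ᵥ K.cupBot s N = 1 := by
    rw [hu, dotProduct_add, K.top_twist_pow_bot, dotProduct_mulVec, ← mulVec_transpose,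
      K.transpose_mulVec_top]
    simp
  rw [show K.cupBot s N = 0 from funext h] at h1
  simp at h1

/-- A finite model at scale `ε` forces odd functions to be simultaneously almost zero. -/
theorem exists_abs_le (K : TwistedComplex X T N ε) (f : ℕ → X → ℝ)
    (hf : ∀ i x, f i (T x) = -f i x) {η : ℝ}
    (hη : ∀ i x y, dist x y < ε → |f i x - f i y| ≤ η) :
    ∃ x, ∀ i < N, |f i x| ≤ N * η := by
  classical
  let s : ℕ → K.Cell → ZMod 2 := fun i b => if f i (K.point b) < 0 then 1 else 0
  have step : ∀ i b c, K.oddCoboundary (s i) b c ≠ 0 →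
      |f i (K.point b)| ≤ η ∧ ∀ j, |f j (K.point b)| ≤ |f j (K.point c)| + η := by
    intro i b c h
    have hentry : K.oddCoboundary (s i) b c =
        K.boundary b c * (s i b + s i c) + K.twist b c := by
      simp only [oddCoboundary, Matrix.add_apply, mul_diagonal, diagonal_mul]
      ring
    rw [hentry] at h
    by_cases hs : s i b = s i c
    · rw [hs, CharTwo.add_self_eq_zero, mul_zero, zero_add] at h
      have hd := K.dist_of_twisted b c h
      have hj := fun j => hη j _ _ hd
      simp only [hf, sub_neg_eq_add] at hj
      refine ⟨?_, fun j => ?_⟩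
      · have := hj i
        simp only [s] at hs
        rw [abs_le] at this ⊢
        split_ifs at hs with h1 h2 h2 <;> first | (simp at hs; done) | constructor <;> linarith
      · have h1 := hj j
        have := abs_sub_abs_le_abs_sub (f j (K.point b)) (-f j (K.point c))
        rw [abs_neg, sub_neg_eq_add] at this
        linarith
    · have hs1 : s i b + s i c = 1 := by
        simp only [s] at hs ⊢
        split_ifs at hs ⊢ <;> simp_all
      rw [hs1, mul_one] at h
      have hd := K.dist_of_untwisted b c h
      have hj := fun j => hη j _ _ hd
      refine ⟨?_, fun j => ?_⟩
      · have := hj i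
        simp only [s] at hs
        rw [abs_le] at this ⊢
        split_ifs at hs with h1 h2 h2 <;> first | (simp at hs; done) | constructor <;> linarith
      · have := abs_sub_abs_le_abs_sub (f j (K.point b)) (f j (K.point c))
        linarith [hj j]
  have main : ∀ i b, K.cupBot s i b ≠ 0 → ∀ j < i, |f j (K.point b)| ≤ i * η := by
    intro i
    induction i with
    | zero => simp
    | succ i ih =>
      intro b hb j hj
      obtain ⟨c, -, hc⟩ := Finset.exists_ne_zero_of_sum_ne_zero hb
      obtain ⟨h1, h2⟩ := step i b c (left_ne_zero_of_mul hc)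
      have hη0 : 0 ≤ η := (abs_nonneg _).trans h1
      push_cast
      rcases Nat.lt_succ_iff_lt_or_eq.mp hj with hj | rfl
      · linarith [ih c (right_ne_zero_of_mul hc) j hj, h2 j]
      · nlinarith [(Nat.cast_nonneg j : (0 : ℝ) ≤ j)]
  obtain ⟨b, hb⟩ := K.exists_cupBot_ne_zero s
  exact ⟨_, main N b hb⟩

end TwistedComplex

/-- If a compact space with an involution has finite models of dimension `N` at all scales, then
`N` odd continuous functions on it have a common zero. -/
theorem exists_common_zero {X : Type*} [PseudoMetricSpace X] [CompactSpace X] {T : X → X} {N : ℕ}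
    (hX : ∀ ε > 0, Nonempty (TwistedComplex X T N ε)) (f : Fin N → X → ℝ)
    (hf : ∀ i, Continuous (f i)) (hodd : ∀ i x, f i (T x) = -f i x) :
    ∃ x, ∀ i, f i x = 0 := by
  let F : X → Fin N → ℝ := fun x i => f i x
  have hF : Continuous F := continuous_pi hf
  have hne : Nonempty X := by
    obtain ⟨K⟩ := hX 1 one_pos
    obtain ⟨b, -⟩ := K.exists_cupBot_ne_zero 0
    exact ⟨K.point b⟩
  obtain ⟨x, -, hx⟩ := isCompact_univ.exists_isMinOn Set.univ_nonempty hF.norm.continuousOn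
  refine ⟨x, fun i => ?_⟩
  suffices h : ‖F x‖ ≤ 0 by
    exact congrFun (norm_le_zero_iff.mp h) i
  refine le_of_forall_pos_le_add fun η hη => ?_
  obtain ⟨ε, hε, hU⟩ := Metric.uniformContinuous_iff.mp
    (CompactSpace.uniformContinuous_of_continuous hF) (η / (N + 1)) (by positivity)
  obtain ⟨K⟩ := hX ε hε
  obtain ⟨y, hy⟩ := K.exists_abs_le (fun i x => if h : i < N then f ⟨i, h⟩ x else 0)
    (fun i x => by split_ifs <;> simp [hodd]) (η := η / (N + 1)) (fun i x y hxy => by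
      split_ifs with h
      · have h1 := hU hxy
        exact (dist_le_pi_dist (F x) (F y) ⟨i, h⟩).trans h1.le
      · simpa using (by positivity : 0 ≤ η / (N + 1)))
  refine (hx (Set.mem_univ y)).trans ?_
  rw [zero_add, pi_norm_le_iff_of_nonneg hη.le]
  intro j
  have h1 := hy j j.2
  simp only [j.2, dif_pos] at h1
  refine h1.trans ?_
  rw [mul_div_assoc', div_le_iff₀ (by positivity)]
  nlinarith

/-- The cells of a half circle whose ends are identified: `m + 1` vertices (left) and `m + 1`
edges (right), the edge `0` being centred at the point where the ends are glued. -/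
abbrev ArcCell (m : ℕ) : Type := ZMod (m + 1) ⊕ ZMod (m + 1)

namespace ArcCell

variable {m : ℕ}

/-- The position of a cell on the half circle, in `[0, π)`. -/
noncomputable def angle : ArcCell m → ℝ
  | .inl i => Real.pi * (i.val + 1 / 2) / (m + 1)
  | .inr j => Real.pi * j.val / (m + 1)

/-- The incidence matrix between edges and vertices. -/
def boundary (m : ℕ) : Matrix (ArcCell m) (ArcCell m) (ZMod 2) :=
  fromBlocks 0 0 (of fun j i => (if j = i then 1 else 0) + if j = i + 1 then 1 else 0) 0

/-- The incidence passing through the glued ends. -/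
def twist (m : ℕ) : Matrix (ArcCell m) (ArcCell m) (ZMod 2) :=
  fromBlocks 0 0 (of fun j i => if j = 0 ∧ i = -1 then 1 else 0) 0

/-- The reflection `t ↦ π - t` of cells. -/
def reflect : ArcCell m → ArcCell m := Sum.map (fun i => -1 - i) fun j => -j

/-- The permutation matrix of the reflection `t ↦ π - t`. -/
def reflection (m : ℕ) : Matrix (ArcCell m) (ArcCell m) (ZMod 2) :=
  of fun s t => if t = reflect s then 1 else 0

/-- The projection onto the edge at the glued ends. -/
def gluing (m : ℕ) : Matrix (ArcCell m) (ArcCell m) (ZMod 2) :=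
  fromBlocks 0 0 0 (of fun j j' => if j = 0 ∧ j' = 0 then 1 else 0)

/-- The sum of the vertices. -/
def vertices (m : ℕ) : ArcCell m → ZMod 2 := Sum.elim 1 0

/-- The sum of the edges. -/
def edges (m : ℕ) : ArcCell m → ZMod 2 := Sum.elim 0 1

/-- The edge at the glued ends. -/
def gluedEdge (m : ℕ) : ArcCell m → ZMod 2 := Sum.elim 0 fun j => if j = 0 then 1 else 0

theorem boundary_mul_self : boundary m * boundary m = 0 := by
  simp [boundary, fromBlocks_multiply]

theorem boundary_mul_twist : boundary m * twist m = 0 := by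
  simp [boundary, twist, fromBlocks_multiply]

theorem twist_mul_boundary : twist m * boundary m = 0 := by
  simp [boundary, twist, fromBlocks_multiply]

theorem reflect_reflect (s : ArcCell m) : reflect (reflect s) = s := by
  rcases s with i | i <;> simp [reflect]

theorem eq_reflect_comm {s t : ArcCell m} : t = reflect s ↔ s = reflect t :=
  ⟨fun h => by rw [h, reflect_reflect], fun h => by rw [h, reflect_reflect]⟩

theorem reflection_mul_apply (A : Matrix (ArcCell m) (ArcCell m) (ZMod 2)) (s t : ArcCell m) :
    (reflection m * A) s t = A (reflect s) t := by
  simp [reflection, Matrix.mul_apply]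

theorem mul_reflection_apply (A : Matrix (ArcCell m) (ArcCell m) (ZMod 2)) (s t : ArcCell m) :
    (A * reflection m) s t = A s (reflect t) := by
  simp [reflection, Matrix.mul_apply, eq_reflect_comm (t := t)]

theorem reflection_mulVec_apply (u : ArcCell m → ZMod 2) (s : ArcCell m) :
    (reflection m *ᵥ u) s = u (reflect s) := by
  simp [reflection, mulVec, dotProduct]

theorem transpose_reflection : (reflection m)ᵀ = reflection m := by
  ext s t
  simp [reflection, eq_reflect_comm]

theorem reflection_mul_self : reflection m * reflection m = 1 := by
  ext s t
  rw [reflection_mul_apply, reflection, of_apply, reflect_reflect, Matrix.one_apply]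
  simp [eq_comm]

theorem commute_boundary_reflection : Commute (boundary m) (reflection m) := by
  ext s t
  rw [mul_reflection_apply, reflection_mul_apply]
  rcases s with i | i <;> rcases t with j | j <;> simp [boundary, reflect]
  rw [add_comm]
  congr 1 <;> congr 1 <;> apply propext <;> constructor <;> intro h <;> grind

theorem reflection_mul_gluing : reflection m * gluing m = gluing m := by
  ext s t
  rw [reflection_mul_apply]
  rcases s with i | i <;> rcases t with j | j <;> simp [gluing, reflect]

theorem gluing_mul_reflection : gluing m * reflection m = gluing m := by
  ext s t
  rw [mul_reflection_apply]
  rcases s with i | i <;> rcases t with j | j <;> simp [gluing, reflect]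

theorem boundary_gluing_add : boundary m * gluing m + gluing m * boundary m =
    reflection m * twist m + twist m * reflection m := by
  ext s t
  rw [Matrix.add_apply, Matrix.add_apply, reflection_mul_apply, mul_reflection_apply]
  rcases s with i | i <;> rcases t with j | j <;>
    simp [gluing, boundary, twist, reflect, fromBlocks_multiply]
  simp only [Matrix.mul_apply, of_apply, ite_and, ite_mul, one_mul, zero_mul]
  by_cases hi : i = 0
  · subst hi
    simp only [if_true, Finset.sum_ite_eq', Finset.mem_univ]
    rw [add_comm]
    congr 1 <;> congr 1 <;> apply propext <;> constructor <;> intro h <;> grind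
  · simp [hi]

theorem boundary_mulVec_vertices : boundary m *ᵥ vertices m = 0 := by
  ext (i | i) <;> simp [boundary, vertices, mulVec, dotProduct, Finset.sum_add_distrib, fromBlocks,
    ← sub_eq_iff_eq_add, CharTwo.add_self_eq_zero]

theorem boundary_transpose_mulVec_edges : (boundary m)ᵀ *ᵥ edges m = 0 := by
  ext (i | i) <;> simp [boundary, edges, mulVec, dotProduct, Finset.sum_add_distrib, fromBlocks,
    CharTwo.add_self_eq_zero]

theorem reflection_mulVec_vertices : reflection m *ᵥ vertices m = vertices m := by
  ext (i | i) <;> simp [reflection_mulVec_apply, vertices, reflect]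

theorem reflection_mulVec_edges : reflection m *ᵥ edges m = edges m := by
  ext (i | i) <;> simp [reflection_mulVec_apply, edges, reflect]

theorem reflection_mulVec_gluedEdge : reflection m *ᵥ gluedEdge m = gluedEdge m := by
  ext (i | i) <;> simp [reflection_mulVec_apply, gluedEdge, reflect]

theorem gluing_mulVec_vertices : gluing m *ᵥ vertices m = 0 := by
  ext (i | i) <;> simp [gluing, vertices, mulVec, dotProduct, fromBlocks]

theorem gluing_mulVec_gluedEdge : gluing m *ᵥ gluedEdge m = gluedEdge m := by
  ext (i | i) <;> simp [gluing, gluedEdge, mulVec, dotProduct, fromBlocks]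

theorem twist_mulVec_vertices : twist m *ᵥ vertices m = gluedEdge m := by
  ext (i | i) <;> simp [twist, vertices, gluedEdge, mulVec, dotProduct, fromBlocks, ite_and]

theorem twist_mulVec_gluedEdge : twist m *ᵥ gluedEdge m = 0 := by
  ext (i | i) <;> simp [twist, gluedEdge, mulVec, dotProduct, fromBlocks]

theorem edges_dotProduct_vertices : edges m ⬝ᵥ vertices m = 0 := by
  simp [edges, vertices, dotProduct]

theorem edges_dotProduct_gluedEdge : edges m ⬝ᵥ gluedEdge m = 1 := by
  simp [edges, gluedEdge, dotProduct]

theorem angle_inr_zero : angle (.inr 0 : ArcCell m) = 0 := by simp [angle]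

theorem angle_mem (t : ArcCell m) : angle t ∈ Set.Icc 0 Real.pi := by
  have hv (i : ZMod (m + 1)) : (i.val : ℝ) + 1 ≤ m + 1 := by exact_mod_cast ZMod.val_lt i
  have := Real.pi_pos
  rcases t with i | i <;> simp only [angle, Set.mem_Icc]
  · refine ⟨by positivity, ?_⟩
    rw [div_le_iff₀ (by positivity)]
    nlinarith [hv i]
  · refine ⟨by positivity, ?_⟩
    rw [div_le_iff₀ (by positivity)]
    nlinarith [hv i]

theorem of_gluing_ne_zero {s t : ArcCell m} (h : gluing m s t ≠ 0) :
    s = .inr 0 ∧ t = .inr 0 := by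
  rcases s with i | i <;> rcases t with j | j <;> simp_all [gluing]

theorem of_twist_ne_zero {s t : ArcCell m} (h : twist m s t ≠ 0) :
    angle s = 0 ∧ angle t = Real.pi - Real.pi / (2 * (m + 1)) := by
  rcases s with i | i <;> rcases t with j | j <;> simp_all [twist]
  obtain ⟨rfl, rfl⟩ := h
  simp [angle, ZMod.val_neg_one]
  field_simp
  ring

theorem angle_of_reflection_add_gluing_ne_zero {s t : ArcCell m}
    (h : (reflection m + gluing m) s t ≠ 0) : angle t = Real.pi - angle s := by
  rcases s with i | i <;> rcases t with j | j <;>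
    simp only [reflection, gluing, reflect, Matrix.add_apply, of_apply, Sum.map_inl, Sum.map_inr,
      Sum.inl.injEq, Sum.inr.injEq, reduceCtorEq, fromBlocks_apply₁₁, fromBlocks_apply₁₂,
      fromBlocks_apply₂₁, fromBlocks_apply₂₂, Matrix.zero_apply, if_false, add_zero, ne_eq,
      not_true_eq_false] at h
  · have hj : j = -1 - i := by by_contra h'; simp [h'] at h
    have h1 : (j.val : ℝ) = m - i.val := by
      have : i.val ≤ (-1 : ZMod (m + 1)).val := by
        rw [ZMod.val_neg_one]; exact Nat.lt_succ_iff.mp (ZMod.val_lt i)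
      rw [hj, ZMod.val_sub this, Nat.cast_sub this, ZMod.val_neg_one]
    simp only [angle, h1]
    field_simp
    ring
  · have hi : i ≠ 0 := by
      rintro rfl
      by_cases hj : j = 0 <;> simp [hj, CharTwo.add_self_eq_zero] at h
    have hj : j = -i := by by_contra h'; simp [h', hi] at h
    have : NeZero i := ⟨hi⟩
    have h1 : (j.val : ℝ) = m + 1 - i.val := by
      rw [hj, ZMod.val_neg_of_ne_zero, Nat.cast_sub (ZMod.val_lt i).le]
      push_cast
      ring
    simp only [angle, h1]
    field_simp

theorem abs_angle_sub_of_ne_zero {s t : ArcCell m} (h : (boundary m + twist m) s t ≠ 0) :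
    |angle s - angle t| ≤ Real.pi / (2 * (m + 1)) := by
  have hpos : 0 ≤ Real.pi / (2 * (m + 1)) := by positivity
  rcases s with i | i <;> rcases t with j | j <;>
    simp only [boundary, twist, Matrix.add_apply, of_apply, fromBlocks_apply₁₁,
      fromBlocks_apply₁₂, fromBlocks_apply₂₁, fromBlocks_apply₂₂, Matrix.zero_apply, add_zero,
      ne_eq, not_true_eq_false] at h
  by_cases hij : i = j
  · have : angle (.inr i : ArcCell m) - angle (.inl j) = -(Real.pi / (2 * (m + 1))) := by
      subst hij
      simp only [angle]
      field_simp
      ring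
    rw [this, abs_neg, abs_of_nonneg hpos]
  · have hi : i = j + 1 := by
      by_contra h'
      have : ¬(i = 0 ∧ j = -1) := by rintro ⟨rfl, rfl⟩; simp at h'
      simp [hij, h', this] at h
    have hj : j ≠ -1 := by
      rintro rfl
      have hi0 : i = 0 := by simpa using hi
      subst hi0
      simp [hij, CharTwo.add_self_eq_zero] at h
    have h1 : (i.val : ℝ) = j.val + 1 := by
      have hlt : j.val < m := by
        refine lt_of_le_of_ne (Nat.lt_succ_iff.mp (ZMod.val_lt j)) fun h' => hj ?_
        exact ZMod.val_injective _ (by rw [h', ZMod.val_neg_one])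
      have h11 : (1 : ZMod (m + 1)).val = 1 := ZMod.val_one'' (by omega)
      rw [hi, ZMod.val_add_of_lt (by omega), h11]
      push_cast
      ring
    have : angle (.inr i : ArcCell m) - angle (.inl j) = Real.pi / (2 * (m + 1)) := by
      simp only [angle, h1]
      field_simp
      ring
    rw [this, abs_of_nonneg hpos]

end ArcCell

section TripleKronecker

variable {R X Y Z : Type*} [CommRing R]

/-- The Kronecker product of three square matrices. -/
def kron (A : Matrix X X R) (B : Matrix Y Y R) (C : Matrix Z Z R) :
    Matrix ((X × Y) × Z) ((X × Y) × Z) R :=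
  (A ⊗ₖ B) ⊗ₖ C

/-- The tensor product of three vectors. -/
def tens (u : X → R) (v : Y → R) (w : Z → R) : (X × Y) × Z → R :=
  fun t => u t.1.1 * v t.1.2 * w t.2

theorem kron_apply (A : Matrix X X R) (B : Matrix Y Y R) (C : Matrix Z Z R)
    (s t : (X × Y) × Z) :
    kron A B C s t = A s.1.1 t.1.1 * B s.1.2 t.1.2 * C s.2 t.2 := rfl

theorem transpose_kron (A : Matrix X X R) (B : Matrix Y Y R) (C : Matrix Z Z R) :
    (kron A B C)ᵀ = kron Aᵀ Bᵀ Cᵀ := rfl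

theorem kron_add_right (A : Matrix X X R) (B : Matrix Y Y R) (C C' : Matrix Z Z R) :
    kron A B (C + C') = kron A B C + kron A B C' := kronecker_add _ _ _

theorem kron_add_left (A A' : Matrix X X R) (B : Matrix Y Y R) (C : Matrix Z Z R) :
    kron (A + A') B C = kron A B C + kron A' B C := by
  simp only [kron, add_kronecker]

theorem kron_add_middle (A : Matrix X X R) (B B' : Matrix Y Y R) (C : Matrix Z Z R) :
    kron A (B + B') C = kron A B C + kron A B' C := by
  simp only [kron, add_kronecker, kronecker_add]

theorem tens_zero_left (v : Y → R) (w : Z → R) : tens (0 : X → R) v w = 0 := by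
  ext; simp [tens]

theorem tens_zero_middle (u : X → R) (w : Z → R) : tens u (0 : Y → R) w = 0 := by
  ext; simp [tens]

theorem tens_zero_right (u : X → R) (v : Y → R) : tens u v (0 : Z → R) = 0 := by
  ext; simp [tens]

theorem kron_zero_left (B : Matrix Y Y R) (C : Matrix Z Z R) :
    kron (0 : Matrix X X R) B C = 0 := by
  ext; simp [kron_apply]

theorem kron_zero_middle (A : Matrix X X R) (C : Matrix Z Z R) :
    kron A (0 : Matrix Y Y R) C = 0 := by
  ext; simp [kron_apply]

theorem kron_zero_right (A : Matrix X X R) (B : Matrix Y Y R) :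
    kron A B (0 : Matrix Z Z R) = 0 := by
  ext; simp [kron_apply]

variable [Fintype X] [Fintype Y] [Fintype Z]

theorem kron_mul (A A' : Matrix X X R) (B B' : Matrix Y Y R) (C C' : Matrix Z Z R) :
    kron A B C * kron A' B' C' = kron (A * A') (B * B') (C * C') := by
  simp only [kron, mul_kronecker_mul]

theorem kron_mulVec_tens (A : Matrix X X R) (B : Matrix Y Y R) (C : Matrix Z Z R)
    (u : X → R) (v : Y → R) (w : Z → R) :
    kron A B C *ᵥ tens u v w = tens (A *ᵥ u) (B *ᵥ v) (C *ᵥ w) := by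
  ext ⟨⟨x, y⟩, z⟩
  simp only [tens, mulVec, dotProduct, Fintype.sum_mul_sum, ← Fintype.sum_prod_type']
  refine Finset.sum_congr rfl fun i _ => ?_
  change A x i.1.1 * B y i.1.2 * C z i.2 * _ = _
  ring

theorem tens_dotProduct_tens (u u' : X → R) (v v' : Y → R) (w w' : Z → R) :
    tens u v w ⬝ᵥ tens u' v' w' = (u ⬝ᵥ u') * (v ⬝ᵥ v') * (w ⬝ᵥ w') := by
  simp only [tens, dotProduct, Fintype.sum_mul_sum, ← Fintype.sum_prod_type']
  refine Finset.sum_congr rfl fun _ _ => ?_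
  ring

theorem Commute.kron {A A' : Matrix X X R} {B B' : Matrix Y Y R} {C C' : Matrix Z Z R}
    (hA : Commute A A') (hB : Commute B B') (hC : Commute C C') :
    Commute (kron A B C) (kron A' B' C') := by
  rw [commute_iff_eq, kron_mul, kron_mul, hA.eq, hB.eq, hC.eq]

end TripleKronecker

/-- In characteristic two, the sum of two commuting elements of square zero has square zero. -/
theorem Commute.add_mul_self_eq_zero {R : Type*} [Ring R] (h2 : ∀ x : R, x + x = 0) {a b : R}
    (h : Commute a b) (ha : a * a = 0) (hb : b * b = 0) : (a + b) * (a + b) = 0 := by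
  rw [add_mul, mul_add, mul_add, ha, hb, h.eq, zero_add, add_zero, h2]

theorem Matrix.add_self_eq_zero_of_charP_two {n R : Type*} [Ring R] [CharP R 2]
    (A : Matrix n n R) : A + A = 0 := by
  ext
  exact CharTwo.add_self_eq_zero _

theorem commute_add_mul_of_exchange {R : Type*} [Ring R] {e h r v w : R} (he : Commute h e)
    (hr : Commute h r) (hv : Commute h v) (hw : Commute h w) (hew : Commute e w)
    (hrv : Commute r v) (key : e * v + r * w = v * e + w * r) :
    Commute (e + h * (1 + r)) (h * v + w) := by
  have h1 : Commute (h * (1 + r)) (h * v) :=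
    .mul_left (.mul_right (.refl h) hv) (.mul_right ((Commute.one_left h).add_left hr.symm)
      ((Commute.one_left v).add_left hrv))
  calc (e + h * (1 + r)) * (h * v + w)
      = e * h * v + e * w + h * (1 + r) * (h * v) + h * w + h * (r * w) := by noncomm_ring
    _ = h * (e * v + r * w) + (e * w + h * (1 + r) * (h * v) + h * w) := by
      rw [← he.eq]; noncomm_ring
    _ = h * v * e + (h * w) * r + (w * e + h * v * (h * (1 + r)) + h * w) := by
      rw [key, hew.eq, h1.eq]; noncomm_ring
    _ = (h * v + w) * (e + h * (1 + r)) := by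
      rw [hw.eq]; noncomm_ring

namespace TwistedComplex

variable {X Y Z : Type*} [PseudoMetricSpace X] [PseudoMetricSpace Y] [PseudoMetricSpace Z]
  {S : X → X} {T : Y → Y} {U : Z → Z} {p q : ℕ} {δ ε : ℝ}

/-- The cells of the circle bundle over the product of two complexes. -/
abbrev JoinCell (K : TwistedComplex X S p δ) (L : TwistedComplex Y T q δ) (m : ℕ) : Type :=
  (K.Cell × L.Cell) × ArcCell m

variable (K : TwistedComplex X S p δ) (L : TwistedComplex Y T q δ) (m : ℕ)

/-- The incidence matrix of the circle bundle: changing sheets in either factor reflects the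
fibre. -/
def joinBoundary : Matrix (JoinCell K L m) (JoinCell K L m) (ZMod 2) :=
  kron K.boundary 1 1 + kron 1 L.boundary 1 +
    (kron 1 1 (ArcCell.boundary m) + (kron K.twist 1 (1 + ArcCell.reflection m) +
      kron 1 L.twist (1 + ArcCell.reflection m)))

/-- The sheet-changing part of the incidence matrix of the circle bundle. -/
def joinTwist : Matrix (JoinCell K L m) (JoinCell K L m) (ZMod 2) :=
  kron K.twist 1 (ArcCell.reflection m + ArcCell.gluing m) + kron 1 L.twist (ArcCell.gluing m) +
    kron 1 1 (ArcCell.twist m)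

theorem joinBoundary_mul_self : joinBoundary K L m * joinBoundary K L m = 0 := by
  have h2 := Matrix.add_self_eq_zero_of_charP_two (n := JoinCell K L m) (R := ZMod 2)
  have hR : (1 + ArcCell.reflection m) * (1 + ArcCell.reflection m) = 0 := by
    rw [add_mul, mul_add, mul_add, ArcCell.reflection_mul_self, one_mul, mul_one, one_mul,
      add_comm (ArcCell.reflection m), CharTwo.add_self_eq_zero]
  have hc : Commute (ArcCell.boundary m) (1 + ArcCell.reflection m) :=
    (Commute.one_right _).add_right ArcCell.commute_boundary_reflection
  have o {A : Type} [Fintype A] [DecidableEq A] (M : Matrix A A (ZMod 2)) : Commute 1 M :=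
    Commute.one_left M
  have o' {A : Type} [Fintype A] [DecidableEq A] (M : Matrix A A (ZMod 2)) : Commute M 1 :=
    Commute.one_right M
  refine Commute.add_mul_self_eq_zero h2 ?_ (Commute.add_mul_self_eq_zero h2 ?_ ?_ ?_)
    (Commute.add_mul_self_eq_zero h2 ?_ ?_ (Commute.add_mul_self_eq_zero h2 ?_ ?_ ?_))
  · refine .add_left (.add_right ?_ (.add_right ?_ ?_)) (.add_right ?_ (.add_right ?_ ?_))
    · exact .kron (o' _) (o _) (o _)
    · exact .kron K.commute (o _) (o _)
    · exact .kron (o' _) (o _) (o _)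
    · exact .kron (o _) (o' _) (o _)
    · exact .kron (o _) (o' _) (o _)
    · exact .kron (o _) L.commute (o _)
  · exact .kron (o' _) (o _) (o _)
  · rw [kron_mul, K.boundary_mul_self, kron_zero_left]
  · rw [kron_mul, L.boundary_mul_self, kron_zero_middle]
  · exact .add_right (.kron (o _) (o _) hc) (.kron (o _) (o _) hc)
  · rw [kron_mul, ArcCell.boundary_mul_self, kron_zero_right]
  · exact .kron (o' _) (o _) (.refl _)
  · rw [kron_mul, hR, kron_zero_right]
  · rw [kron_mul, hR, kron_zero_right]

theorem commute_joinBoundary_joinTwist : Commute (joinBoundary K L m) (joinTwist K L m) := by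
  have o {A : Type} [Fintype A] [DecidableEq A] (M : Matrix A A (ZMod 2)) : Commute 1 M :=
    Commute.one_left M
  have o' {A : Type} [Fintype A] [DecidableEq A] (M : Matrix A A (ZMod 2)) : Commute M 1 :=
    Commute.one_right M
  have hRR : Commute (1 + ArcCell.reflection m) (ArcCell.reflection m) :=
    (o _).add_left (.refl _)
  have key : ArcCell.boundary m * ArcCell.gluing m + ArcCell.reflection m * ArcCell.twist m =
      ArcCell.gluing m * ArcCell.boundary m + ArcCell.twist m * ArcCell.reflection m := by
    have := ArcCell.boundary_gluing_add (m := m)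
    rw [← sub_eq_zero, CharTwo.sub_eq_add] at this ⊢
    rw [← this]
    abel
  set h : Matrix (JoinCell K L m) (JoinCell K L m) (ZMod 2) :=
    kron K.twist 1 1 + kron 1 L.twist 1 with hh
  have hc (M : Matrix (ArcCell m) (ArcCell m) (ZMod 2)) : Commute h (kron 1 1 M) :=
    .add_left (.kron (o' _) (o _) (o _)) (.kron (o _) (o' _) (o _))
  have hcore : Commute (kron 1 1 (ArcCell.boundary m) + h * (1 + kron 1 1 (ArcCell.reflection m)))
      (h * kron 1 1 (ArcCell.gluing m) + kron 1 1 (ArcCell.twist m)) := by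
    refine commute_add_mul_of_exchange (hc _) (hc _) (hc _) (hc _) ?_ ?_ ?_
    · refine .kron (o _) (o _) ?_
      rw [commute_iff_eq, ArcCell.boundary_mul_twist, ArcCell.twist_mul_boundary]
    · refine .kron (o _) (o _) ?_
      rw [commute_iff_eq, ArcCell.reflection_mul_gluing, ArcCell.gluing_mul_reflection]
    · simp only [kron_mul, ← kron_add_right, key]
  have hB : joinBoundary K L m = kron K.boundary 1 1 + (kron 1 L.boundary 1 +
      (kron 1 1 (ArcCell.boundary m) + h * (1 + kron 1 1 (ArcCell.reflection m)))) := by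
    rw [joinBoundary, hh, add_mul, mul_add, mul_add, kron_mul, kron_mul, kron_add_right,
      kron_add_right]
    simp only [mul_one, one_mul, add_assoc]
  have hT : joinTwist K L m = kron K.twist 1 (ArcCell.reflection m) +
      (h * kron 1 1 (ArcCell.gluing m) + kron 1 1 (ArcCell.twist m)) := by
    rw [joinTwist, hh, add_mul, kron_mul, kron_mul, kron_add_right]
    simp only [mul_one, one_mul, add_assoc]
  have hX (M N) : Commute (kron K.boundary 1 1) (kron K.twist M N : Matrix (JoinCell K L m) _ _) :=
    .kron K.commute (o _) (o _)
  have hX' (M N) : Commute (kron K.boundary 1 1) (kron 1 M N : Matrix (JoinCell K L m) _ _) :=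
    .kron (o' _) (o _) (o _)
  have hY (M N) : Commute (kron 1 L.boundary 1) (kron M L.twist N : Matrix (JoinCell K L m) _ _) :=
    .kron (o _) L.commute (o _)
  have hY' (M N) : Commute (kron 1 L.boundary 1) (kron M 1 N : Matrix (JoinCell K L m) _ _) :=
    .kron (o _) (o' _) (o _)
  rw [hB, hT]
  refine Commute.add_left ?_ (Commute.add_left ?_ (Commute.add_right ?_ hcore))
  · exact Commute.add_right (hX _ _) (Commute.add_right (Commute.mul_right
      (Commute.add_right (hX _ _) (hX' _ _)) (hX' _ _)) (hX' _ _))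
  · exact Commute.add_right (hY' _ _) (Commute.add_right (Commute.mul_right
      (Commute.add_right (hY' _ _) (hY _ _)) (hY' _ _)) (hY' _ _))
  · refine Commute.add_left (Commute.kron (o _) (o _) ArcCell.commute_boundary_reflection)
      (Commute.mul_left (Commute.add_left (Commute.kron (.refl _) (o _) (o _))
      (Commute.kron (o _) (o' _) (o _))) (Commute.add_left (Commute.one_left _)
      (Commute.kron (o _) (o _) (.refl _))))

/-- The sum of the cells of top dimension of the circle bundle. -/
def joinTop : JoinCell K L m → ZMod 2 := tens K.top L.top (ArcCell.edges m)

/-- The sum of the vertices of the circle bundle. -/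
def joinBot : JoinCell K L m → ZMod 2 := tens K.bot L.bot (ArcCell.vertices m)

theorem one_add_reflection_mulVec {u : ArcCell m → ZMod 2} (h : ArcCell.reflection m *ᵥ u = u) :
    (1 + ArcCell.reflection m) *ᵥ u = 0 := by
  rw [add_mulVec, one_mulVec, h]
  ext
  exact CharTwo.add_self_eq_zero _

theorem joinBoundary_mulVec_joinBot : joinBoundary K L m *ᵥ joinBot K L m = 0 := by
  have h := one_add_reflection_mulVec m (ArcCell.reflection_mulVec_vertices (m := m))
  simp only [joinBoundary, joinBot, add_mulVec, kron_mulVec_tens, K.mulVec_bot, L.mulVec_bot,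
    ArcCell.boundary_mulVec_vertices, tens_zero_left, tens_zero_middle, tens_zero_right, h,
    add_zero]

theorem transpose_joinBoundary_mulVec_joinTop :
    (joinBoundary K L m)ᵀ *ᵥ joinTop K L m = 0 := by
  have h := one_add_reflection_mulVec m (ArcCell.reflection_mulVec_edges (m := m))
  simp only [joinBoundary, joinTop, transpose_add, transpose_kron, transpose_one,
    ArcCell.transpose_reflection, add_mulVec, kron_mulVec_tens, K.transpose_mulVec_top,
    L.transpose_mulVec_top, ArcCell.boundary_transpose_mulVec_edges]
  simp only [← add_mulVec, tens_zero_left, tens_zero_middle, tens_zero_right, h, add_zero]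

theorem joinTwist_mulVec_vertices (u : K.Cell → ZMod 2) (v : L.Cell → ZMod 2) :
    joinTwist K L m *ᵥ tens u v (ArcCell.vertices m) =
      tens (K.twist *ᵥ u) v (ArcCell.vertices m) + tens u v (ArcCell.gluedEdge m) := by
  simp only [joinTwist, add_mulVec, kron_mulVec_tens, one_mulVec,
    ArcCell.reflection_mulVec_vertices, ArcCell.gluing_mulVec_vertices,
    ArcCell.twist_mulVec_vertices, tens_zero_right, add_zero]

theorem joinTwist_mulVec_gluedEdge (u : K.Cell → ZMod 2) (v : L.Cell → ZMod 2) :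
    joinTwist K L m *ᵥ tens u v (ArcCell.gluedEdge m) =
      tens u (L.twist *ᵥ v) (ArcCell.gluedEdge m) := by
  have h : ArcCell.gluedEdge m + ArcCell.gluedEdge m = 0 := by
    ext
    exact CharTwo.add_self_eq_zero _
  simp only [joinTwist, add_mulVec, kron_mulVec_tens, one_mulVec,
    ArcCell.reflection_mulVec_gluedEdge, ArcCell.gluing_mulVec_gluedEdge,
    ArcCell.twist_mulVec_gluedEdge, tens_zero_right, add_zero, h, zero_add]

theorem joinTwist_pow_mulVec_joinBot (k : ℕ) :
    joinTwist K L m ^ k *ᵥ joinBot K L m =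
      tens (K.twist ^ k *ᵥ K.bot) L.bot (ArcCell.vertices m) +
        ∑ i ∈ Finset.range k,
          tens (K.twist ^ i *ᵥ K.bot) (L.twist ^ (k - 1 - i) *ᵥ L.bot) (ArcCell.gluedEdge m) := by
  induction k with
  | zero => simp [joinBot]
  | succ k ih =>
    rw [pow_succ', ← mulVec_mulVec, ih, mulVec_add, joinTwist_mulVec_vertices, mulVec_sum,
      Finset.sum_range_succ, mulVec_mulVec, ← pow_succ', add_assoc]
    congr 1
    rw [add_comm]
    congr 1
    · refine Finset.sum_congr rfl fun i hi => ?_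
      rw [joinTwist_mulVec_gluedEdge, mulVec_mulVec, ← pow_succ']
      congr 3
      have := Finset.mem_range.1 hi
      omega
    · simp

theorem joinTop_dotProduct (k : ℕ) :
    joinTop K L m ⬝ᵥ (joinTwist K L m ^ k *ᵥ joinBot K L m) = if k = p + q + 1 then 1 else 0 := by
  rw [joinTwist_pow_mulVec_joinBot, dotProduct_add, dotProduct_sum]
  simp only [joinTop, tens_dotProduct_tens, ArcCell.edges_dotProduct_vertices,
    ArcCell.edges_dotProduct_gluedEdge, K.top_twist_pow_bot, L.top_twist_pow_bot, mul_zero,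
    zero_add, mul_one, ite_mul, one_mul, zero_mul, Finset.sum_ite_eq', Finset.mem_range]
  rw [← ite_and]
  congr 1
  apply propext
  omega

theorem joinBoundary_add_joinTwist :
    joinBoundary K L m + joinTwist K L m =
      kron (K.boundary + K.twist) 1 1 + kron 1 (L.boundary + L.twist) 1 +
        kron K.twist 1 (ArcCell.gluing m) +
        kron 1 L.twist (ArcCell.reflection m + ArcCell.gluing m) +
        kron 1 1 (ArcCell.boundary m + ArcCell.twist m) := by
  have h := Matrix.add_self_eq_zero_of_charP_two
    (kron K.twist (1 : Matrix L.Cell L.Cell (ZMod 2)) (ArcCell.reflection m))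
  simp only [joinBoundary, joinTwist, kron_add_left, kron_add_middle, kron_add_right]
  rw [← sub_eq_zero]
  abel_nf
  rw [two_smul, h]

theorem of_kron_ne_zero {A B C : Type*} {M : Matrix A A (ZMod 2)} {N : Matrix B B (ZMod 2)}
    {P : Matrix C C (ZMod 2)} {s t : (A × B) × C} (h : kron M N P s t ≠ 0) :
    M s.1.1 t.1.1 ≠ 0 ∧ N s.1.2 t.1.2 ≠ 0 ∧ P s.2 t.2 ≠ 0 := by
  rw [kron_apply] at h
  exact ⟨left_ne_zero_of_mul (left_ne_zero_of_mul h),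
    right_ne_zero_of_mul (left_ne_zero_of_mul h), right_ne_zero_of_mul h⟩

theorem eq_of_one_apply_ne_zero {A : Type*} [DecidableEq A] {s t : A}
    (h : (1 : Matrix A A (ZMod 2)) s t ≠ 0) : s = t := by
  by_contra hst
  exact h (Matrix.one_apply_ne hst)

/-- The circle bundle over the product of two complexes, realised by a map
`Φ : X × Y × ℝ → Z` that is compatible with the involutions. -/
noncomputable def join {Φ : X → Y → ℝ → Z} (hS : ∀ x y t, Φ (S x) y t = Φ x y (-t))
    (hT : ∀ x y t, Φ x (T y) t = Φ x y (Real.pi - t))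
    (hU : ∀ x y t, U (Φ x y t) = Φ x y (t - Real.pi))
    (hper : ∀ x y t, Φ x y (t + 2 * Real.pi) = Φ x y t) (hδ : 0 < δ)
    (hΦ : ∀ x x' y y', ∀ t ∈ Set.Icc (-Real.pi) Real.pi, ∀ t' ∈ Set.Icc (-Real.pi) Real.pi,
      dist x x' < δ → dist y y' < δ → |t - t'| < δ → dist (Φ x y t) (Φ x' y' t') < ε)
    (hm : Real.pi / (2 * (m + 1)) < δ) : TwistedComplex Z U (p + q + 1) ε where
  Cell := JoinCell K L m
  boundary := joinBoundary K L m
  twist := joinTwist K L m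
  top := joinTop K L m
  bot := joinBot K L m
  point c := Φ (K.point c.1.1) (L.point c.1.2) (ArcCell.angle c.2)
  boundary_mul_self := joinBoundary_mul_self K L m
  commute := commute_joinBoundary_joinTwist K L m
  transpose_mulVec_top := transpose_joinBoundary_mulVec_joinTop K L m
  mulVec_bot := joinBoundary_mulVec_joinBot K L m
  top_twist_pow_bot := joinTop_dotProduct K L m
  dist_of_untwisted := by
    rintro ⟨⟨x, y⟩, s⟩ ⟨⟨x', y'⟩, t⟩ h
    have hI (s : ArcCell m) : ArcCell.angle s ∈ Set.Icc (-Real.pi) Real.pi :=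
      Set.Icc_subset_Icc_left (by linarith [Real.pi_pos]) (ArcCell.angle_mem s)
    have hdX (w : X) : dist w w < δ := by rwa [dist_self]
    have hdY (w : Y) : dist w w < δ := by rwa [dist_self]
    have hd' (s : ℝ) : |s - s| < δ := by rwa [sub_self, abs_zero]
    rw [joinBoundary_add_joinTwist] at h
    by_cases h1 : kron (K.boundary + K.twist) 1 1 ((x, y), s) ((x', y'), t) = 0
    swap
    · obtain ⟨hx, hy, hs⟩ := of_kron_ne_zero h1
      obtain rfl := eq_of_one_apply_ne_zero hy
      obtain rfl := eq_of_one_apply_ne_zero hs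
      exact hΦ _ _ _ _ _ (hI s) _ (hI s) (K.dist_of_untwisted _ _ hx) (hdY _) (hd' _)
    by_cases h2 : kron 1 (L.boundary + L.twist) 1 ((x, y), s) ((x', y'), t) = 0
    swap
    · obtain ⟨hx, hy, hs⟩ := of_kron_ne_zero h2
      obtain rfl := eq_of_one_apply_ne_zero hx
      obtain rfl := eq_of_one_apply_ne_zero hs
      exact hΦ _ _ _ _ _ (hI s) _ (hI s) (hdX _) (L.dist_of_untwisted _ _ hy) (hd' _)
    by_cases h3 : kron K.twist 1 (ArcCell.gluing m) ((x, y), s) ((x', y'), t) = 0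
    swap
    · obtain ⟨hx, hy, hs⟩ := of_kron_ne_zero h3
      obtain rfl := eq_of_one_apply_ne_zero hy
      obtain ⟨rfl, rfl⟩ := ArcCell.of_gluing_ne_zero hs
      have := hΦ _ _ _ _ _ (hI (.inr 0)) _ (hI (.inr 0)) (K.dist_of_twisted _ _ hx)
        (hdY (L.point y)) (hd' _)
      rw [hS] at this
      simpa only [ArcCell.angle_inr_zero, neg_zero] using this
    by_cases h4 : kron 1 L.twist (ArcCell.reflection m + ArcCell.gluing m)
        ((x, y), s) ((x', y'), t) = 0
    swap
    · obtain ⟨hx, hy, hs⟩ := of_kron_ne_zero h4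
      obtain rfl := eq_of_one_apply_ne_zero hx
      have := hΦ _ _ _ _ _ (hI s) _ (hI s) (hdX (K.point x)) (L.dist_of_twisted _ _ hy) (hd' _)
      rwa [hT, ← ArcCell.angle_of_reflection_add_gluing_ne_zero hs] at this
    have h5 : kron 1 1 (ArcCell.boundary m + ArcCell.twist m) ((x, y), s) ((x', y'), t) ≠ 0 := by
      intro h5
      apply h
      simp only [Matrix.add_apply] at h1 h2 h3 h4 h5 ⊢
      rw [h1, h2, h3, h4, h5]
      rfl
    obtain ⟨hx, hy, hs⟩ := of_kron_ne_zero h5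
    obtain rfl := eq_of_one_apply_ne_zero hx
    obtain rfl := eq_of_one_apply_ne_zero hy
    exact hΦ _ _ _ _ _ (hI s) _ (hI t) (hdX _) (hdY _)
      ((ArcCell.abs_angle_sub_of_ne_zero hs).trans_lt hm)
  dist_of_twisted := by
    rintro ⟨⟨x, y⟩, s⟩ ⟨⟨x', y'⟩, t⟩ h
    have hI (s : ArcCell m) : ArcCell.angle s ∈ Set.Icc (-Real.pi) Real.pi :=
      Set.Icc_subset_Icc_left (by linarith [Real.pi_pos]) (ArcCell.angle_mem s)
    have hdX (w : X) : dist w w < δ := by rwa [dist_self]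
    have hdY (w : Y) : dist w w < δ := by rwa [dist_self]
    have hd' (s : ℝ) : |s - s| < δ := by rwa [sub_self, abs_zero]
    by_cases h1 : kron K.twist 1 (ArcCell.reflection m + ArcCell.gluing m)
        ((x, y), s) ((x', y'), t) = 0
    swap
    · obtain ⟨hx, hy, hs⟩ := of_kron_ne_zero h1
      obtain rfl := eq_of_one_apply_ne_zero hy
      have := hΦ _ _ _ _ _ (hI s) _ (hI s) (K.dist_of_twisted _ _ hx) (hdY (L.point y)) (hd' _)
      rw [hS] at this
      rwa [hU, ArcCell.angle_of_reflection_add_gluing_ne_zero hs, sub_sub_cancel_left]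
    by_cases h2 : kron 1 L.twist (ArcCell.gluing m) ((x, y), s) ((x', y'), t) = 0
    swap
    · obtain ⟨hx, hy, hs⟩ := of_kron_ne_zero h2
      obtain rfl := eq_of_one_apply_ne_zero hx
      obtain ⟨rfl, rfl⟩ := ArcCell.of_gluing_ne_zero hs
      have := hΦ _ _ _ _ _ (hI (.inr 0)) _ (hI (.inr 0)) (hdX (K.point x))
        (L.dist_of_twisted _ _ hy) (hd' _)
      rw [hU, ← hper _ _ (_ - Real.pi), ArcCell.angle_inr_zero,
        show 0 - Real.pi + 2 * Real.pi = Real.pi - 0 by ring, ← hT]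
      rwa [ArcCell.angle_inr_zero] at this
    have h3 : kron 1 1 (ArcCell.twist m) ((x, y), s) ((x', y'), t) ≠ 0 := by
      intro h3
      apply h
      rw [joinTwist, Matrix.add_apply, Matrix.add_apply, h1, h2, h3]
      rfl
    obtain ⟨hx, hy, hs⟩ := of_kron_ne_zero h3
    obtain rfl := eq_of_one_apply_ne_zero hx
    obtain rfl := eq_of_one_apply_ne_zero hy
    obtain ⟨hs, ht⟩ := ArcCell.of_twist_ne_zero hs
    have hpos : 0 ≤ Real.pi / (2 * (m + 1)) := by positivity
    have hle : Real.pi / (2 * (m + 1)) ≤ Real.pi :=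
      div_le_self Real.pi_pos.le (by linarith [Nat.cast_nonneg (α := ℝ) m])
    simp only [hU, hs, ht]
    refine hΦ _ _ _ _ _ ⟨by linarith, by linarith⟩ _ ⟨by linarith, by linarith⟩ (hdX _) (hdY _) ?_
    rwa [show (0 : ℝ) - (Real.pi - Real.pi / (2 * (m + 1)) - Real.pi) =
      Real.pi / (2 * (m + 1)) by ring, abs_of_nonneg hpos]

end TwistedComplex

/-- Spaces with approximations of all scales are stable under circle bundles over products. -/
theorem nonempty_twistedComplex_join {X Y Z : Type*} [PseudoMetricSpace X] [CompactSpace X]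
    [PseudoMetricSpace Y] [CompactSpace Y] [PseudoMetricSpace Z]
    {S : X → X} {T : Y → Y} {U : Z → Z} {p q : ℕ}
    (hX : ∀ ε > 0, Nonempty (TwistedComplex X S p ε))
    (hY : ∀ ε > 0, Nonempty (TwistedComplex Y T q ε))
    {Φ : X → Y → ℝ → Z} (hcont : Continuous fun w : (X × Y) × ℝ => Φ w.1.1 w.1.2 w.2)
    (hS : ∀ x y t, Φ (S x) y t = Φ x y (-t))
    (hT : ∀ x y t, Φ x (T y) t = Φ x y (Real.pi - t))
    (hU : ∀ x y t, U (Φ x y t) = Φ x y (t - Real.pi))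
    (hper : ∀ x y t, Φ x y (t + 2 * Real.pi) = Φ x y t) {ε : ℝ} (hε : 0 < ε) :
    Nonempty (TwistedComplex Z U (p + q + 1) ε) := by
  have hK : IsCompact ((Set.univ : Set (X × Y)) ×ˢ Set.Icc (-Real.pi) Real.pi) :=
    isCompact_univ.prod isCompact_Icc
  obtain ⟨δ, hδ, hΦ⟩ := Metric.uniformContinuousOn_iff.1
    (hK.uniformContinuousOn_of_continuous hcont.continuousOn) ε hε
  obtain ⟨K⟩ := hX δ hδ
  obtain ⟨L⟩ := hY δ hδ
  obtain ⟨m, hm⟩ := exists_nat_gt (Real.pi / δ)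
  refine ⟨TwistedComplex.join K L m hS hT hU hper hδ ?_ ?_⟩
  · intro x x' y y' t ht t' ht' hx hy htt
    refine hΦ ((x, y), t) ⟨trivial, ht⟩ ((x', y'), t') ⟨trivial, ht'⟩ ?_
    simp only [Prod.dist_eq, Real.dist_eq]
    exact max_lt (max_lt hx hy) htt
  · rw [div_lt_iff₀ hδ] at hm
    rw [div_lt_iff₀ (by positivity)]
    nlinarith [Nat.cast_nonneg (α := ℝ) m]

/-- Approximations of all scales push forward along continuous equivariant maps. -/
theorem nonempty_twistedComplex_map {X Y : Type*} [PseudoMetricSpace X] [CompactSpace X]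
    [PseudoMetricSpace Y] {S : X → X} {T : Y → Y} {N : ℕ}
    (hX : ∀ ε > 0, Nonempty (TwistedComplex X S N ε)) {f : X → Y} (hf : Continuous f)
    (hST : ∀ x, f (S x) = T (f x)) {ε : ℝ} (hε : 0 < ε) :
    Nonempty (TwistedComplex Y T N ε) := by
  obtain ⟨δ, hδ, h⟩ := Metric.uniformContinuous_iff.1
    (CompactSpace.uniformContinuous_of_continuous hf) ε hε
  obtain ⟨K⟩ := hX δ hδ
  exact ⟨{ K with
    point := f ∘ K.point
    dist_of_untwisted := fun b c hbc => h (K.dist_of_untwisted b c hbc)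
    dist_of_twisted := fun b c hbc => by
      have := h (K.dist_of_twisted b c hbc)
      rwa [hST] at this }⟩

section SymmetricInvolution

attribute [local instance] Matrix.normedAddCommGroup

variable {I J : Type*} [Fintype I] [DecidableEq I] [Fintype J] [DecidableEq J]

/-- The space of orthogonal reflections in subspaces, as symmetric matrices. -/
abbrev SymmetricInvolution (I : Type*) [Fintype I] [DecidableEq I] : Type _ :=
  {A : Matrix I I ℝ // Aᵀ = A ∧ A * A = 1}

/-- The space of orthogonal reflections in subspaces of half the dimension. -/
abbrev BalancedInvolution (I : Type*) [Fintype I] [DecidableEq I] : Type _ :=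
  {A : SymmetricInvolution I // A.1.trace = 0}

namespace SymmetricInvolution

instance : @CompactSpace (SymmetricInvolution I)
    PseudoMetricSpace.toUniformSpace.toTopologicalSpace := by
  have hK : IsCompact (Set.univ.pi fun _ : I => Set.univ.pi fun _ : I => Set.Icc (-1 : ℝ) 1) :=
    isCompact_univ_pi fun _ => isCompact_univ_pi fun _ => isCompact_Icc
  refine isCompact_iff_compactSpace.1 (IsCompact.of_isClosed_subset hK ?_ ?_)
  · exact (isClosed_eq (by fun_prop) continuous_id).inter (isClosed_eq (by fun_prop) (by fun_prop))
  · rintro A ⟨hA, hA'⟩ i - j -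
    have hsum : ∑ l, A i l * A i l = 1 := by
      have := congrFun (congrFun hA' i) i
      rw [Matrix.mul_apply, Matrix.one_apply_eq] at this
      rw [← this]
      refine Finset.sum_congr rfl fun l _ => ?_
      rw [show A l i = A i l from congrFun (congrFun hA i) l]
    have := Finset.single_le_sum (f := fun l => A i l * A i l)
      (fun l _ => mul_self_nonneg (A i l)) (Finset.mem_univ j)
    simp only [hsum] at this
    exact abs_le.1 (abs_le_one_iff_mul_self_le_one.2 this)

instance : @CompactSpace (BalancedInvolution I)
    PseudoMetricSpace.toUniformSpace.toTopologicalSpace := by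
  refine isCompact_iff_compactSpace.1 (IsClosed.isCompact ?_)
  exact isClosed_eq (by fun_prop) continuous_const

/-- The reflection in the orthogonal complement. -/
instance : Neg (SymmetricInvolution I) :=
  ⟨fun A => ⟨-A.1, by rw [transpose_neg, A.2.1], by rw [neg_mul_neg, A.2.2]⟩⟩

/-- The reflection in the orthogonal complement. -/
instance : Neg (BalancedInvolution I) :=
  ⟨fun A => ⟨-A.1, (trace_neg A.1.1).trans (by rw [A.2, neg_zero])⟩⟩

theorem coe_neg (A : SymmetricInvolution I) : (-A).1 = -A.1 := rfl

theorem coe_coe_neg (A : BalancedInvolution I) : (-A).1.1 = -A.1.1 := rfl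

/-- Conjugation by a bijection of the index set. -/
def reindex (e : I ≃ J) (A : SymmetricInvolution I) : SymmetricInvolution J :=
  ⟨A.1.submatrix e.symm e.symm, by rw [transpose_submatrix, A.2.1], by
    rw [submatrix_mul_equiv, A.2.2, submatrix_one_equiv]⟩

theorem continuous_reindex (e : I ≃ J) : Continuous (reindex e) :=
  Continuous.subtype_mk (by fun_prop) _

theorem trace_reindex (e : I ≃ J) (A : SymmetricInvolution I) :
    (reindex e A).1.trace = A.1.trace :=
  Fintype.sum_equiv e.symm _ _ fun _ => rfl

/-- A circle of reflections in the double of a space, interpolating between a reflection `P` and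
its negative by means of the swaps along `Q` and `-Q`. -/
noncomputable def double (P Q : SymmetricInvolution I) (t : ℝ) : BalancedInvolution (I ⊕ I) :=
  ⟨⟨fromBlocks (Real.sin t • P.1) (Real.cos t • Q.1) (Real.cos t • Q.1)
    (-Real.sin t • (Q.1 * P.1 * Q.1)), by
      rw [fromBlocks_transpose]
      simp only [transpose_smul, transpose_mul, P.2.1, Q.2.1, Matrix.mul_assoc], by
      have h1 : Q.1 * (Q.1 * (P.1 * Q.1)) = P.1 * Q.1 := by
        rw [← Matrix.mul_assoc, Q.2.2, Matrix.one_mul]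
      have h2 : P.1 * (P.1 * Q.1) = Q.1 := by
        rw [← Matrix.mul_assoc, P.2.2, Matrix.one_mul]
      have h3 := Real.sin_sq_add_cos_sq t
      rw [fromBlocks_multiply, ← fromBlocks_one]
      simp only [smul_mul_smul_comm, Matrix.mul_assoc, h1, h2, P.2.2, Q.2.2, Matrix.mul_one,
        ← add_smul]
      congr 1
      · rw [← sq, ← sq, h3, one_smul]
      · rw [show Real.sin t * Real.cos t + Real.cos t * -Real.sin t = 0 by ring, zero_smul]
      · rw [show Real.cos t * Real.sin t + -Real.sin t * Real.cos t = 0 by ring, zero_smul]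
      · rw [show Real.cos t * Real.cos t + -Real.sin t * -Real.sin t = 1 by linarith, one_smul]⟩,
    by
      refine (Fintype.sum_sum_type _).trans ?_
      change trace (Real.sin t • P.1) + trace (-Real.sin t • (Q.1 * P.1 * Q.1)) = 0
      rw [trace_smul, trace_smul, trace_mul_cycle, Q.2.2, Matrix.one_mul, ← add_smul,
        add_neg_cancel, zero_smul]⟩

theorem double_ext {A B : BalancedInvolution I} (h : A.1.1 = B.1.1) : A = B :=
  Subtype.ext (Subtype.ext h)

theorem continuous_double :
    Continuous fun w : (SymmetricInvolution I × SymmetricInvolution I) × ℝ =>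
      double w.1.1 w.1.2 w.2 := by
  refine .subtype_mk (.subtype_mk (Continuous.matrix_fromBlocks ?_ ?_ ?_ ?_) _) _
    <;> fun_prop

theorem double_neg_left (P Q : SymmetricInvolution I) (t : ℝ) :
    double (-P) Q t = double P Q (-t) := by
  apply double_ext
  simp [double, coe_neg]

theorem double_neg_right (P Q : SymmetricInvolution I) (t : ℝ) :
    double P (-Q) t = double P Q (Real.pi - t) := by
  apply double_ext
  simp [double, coe_neg]

theorem neg_double (P Q : SymmetricInvolution I) (t : ℝ) :
    -double P Q t = double P Q (t - Real.pi) := by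
  apply double_ext
  simp [double, coe_coe_neg, fromBlocks_neg, Real.sin_sub_pi, Real.cos_sub_pi]

theorem double_add_two_pi (P Q : SymmetricInvolution I) (t : ℝ) :
    double P Q (t + 2 * Real.pi) = double P Q t := by
  apply double_ext
  simp [double]

theorem nonempty_twistedComplex_balanced {N : ℕ}
    (h : ∀ ε > 0, Nonempty (TwistedComplex (SymmetricInvolution I) Neg.neg N ε))
    (e : I ⊕ I ≃ J) {ε : ℝ} (hε : 0 < ε) :
    Nonempty (TwistedComplex (BalancedInvolution J) Neg.neg (N + N + 1) ε) := by
  refine nonempty_twistedComplex_map (X := BalancedInvolution (I ⊕ I))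
    (fun ε hε => nonempty_twistedComplex_join h h continuous_double double_neg_left
      double_neg_right neg_double double_add_two_pi hε)
    (f := fun A => ⟨reindex e A.1, (trace_reindex e A.1).trans A.2⟩)
    (Continuous.subtype_mk ((continuous_reindex e).comp continuous_subtype_val) _)
    (fun _ => rfl) hε

theorem nonempty_twistedComplex (a b : ℕ) {I : Type} [Fintype I] [DecidableEq I]
    (hI : Fintype.card I = 2 ^ a * b) {ε : ℝ} (hε : 0 < ε) :
    Nonempty (TwistedComplex (SymmetricInvolution I) Neg.neg (2 ^ a - 1) ε) := by
  induction a generalizing I ε with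
  | zero =>
    exact ⟨{
      Cell := Unit
      boundary := 0
      twist := 0
      top := 1
      bot := 1
      point := fun _ => ⟨1, transpose_one, Matrix.one_mul 1⟩
      boundary_mul_self := by simp
      commute := .refl _
      transpose_mulVec_top := by simp
      mulVec_bot := by simp
      top_twist_pow_bot := fun i => by
        rcases i with _ | i <;> simp
      dist_of_untwisted := by simp
      dist_of_twisted := by simp }⟩
  | succ a ih =>
    have e : Fin (2 ^ a * b) ⊕ Fin (2 ^ a * b) ≃ I := Fintype.equivOfCardEq (by
      rw [hI, Fintype.card_sum, Fintype.card_fin]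
      ring)
    have := Nat.one_le_two_pow (n := a)
    rw [show 2 ^ (a + 1) - 1 = (2 ^ a - 1) + (2 ^ a - 1) + 1 by omega]
    exact nonempty_twistedComplex_map
      (fun ε hε => nonempty_twistedComplex_balanced
        (fun ε hε => ih (Fintype.card_fin _) hε) e hε)
      continuous_subtype_val (fun _ => rfl) hε

/-- Odd functions on the space of balanced reflections have common zeros. -/
theorem exists_balanced_common_zero (a b n k : ℕ) (hn : n = 2 ^ a * b)
    (hk : k = 2 ^ (a + 1) - 1) (f : Fin k → BalancedInvolution (Fin (2 * n)) → ℝ)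
    (hf : ∀ i, Continuous (f i)) (hodd : ∀ i A, f i (-A) = -f i A) : ∃ A, ∀ i, f i A = 0 := by
  have e : Fin (2 ^ a * b) ⊕ Fin (2 ^ a * b) ≃ Fin (2 * n) :=
    Fintype.equivOfCardEq (by simp [hn, two_mul])
  refine exists_common_zero (T := Neg.neg) (fun ε hε => ?_) f hf hodd
  have := Nat.one_le_two_pow (n := a)
  rw [show k = (2 ^ a - 1) + (2 ^ a - 1) + 1 by omega]
  exact nonempty_twistedComplex_balanced
    (fun ε hε => nonempty_twistedComplex a b (Fintype.card_fin _) hε) e hε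

end SymmetricInvolution

end SymmetricInvolution

section Reflection

open scoped RealInnerProductSpace

variable {E : Type*} [NormedAddCommGroup E] [InnerProductSpace ℝ E]

/-- The subspace of fixed vectors of an operator. -/
def fixedSpace (u : E →L[ℝ] E) : Submodule ℝ E := LinearMap.eqLocus (u : E →ₗ[ℝ] E) LinearMap.id

theorem mem_fixedSpace {u : E →L[ℝ] E} {x : E} : x ∈ fixedSpace u ↔ u x = x := Iff.rfl

theorem orthogonal_fixedSpace {u : E →L[ℝ] E} (hu : ∀ x y, ⟪u x, y⟫ = ⟪x, u y⟫)
    (huu : ∀ x, u (u x) = x) : (fixedSpace u)ᗮ = fixedSpace (-u) := by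
  ext x
  rw [Submodule.mem_orthogonal, mem_fixedSpace, _root_.neg_apply]
  constructor
  · intro h
    have h1 : u (x + u x) = x + u x := by rw [map_add, huu, add_comm]
    have h2 : ⟪x + u x, x⟫ = 0 := h _ h1
    have h3 : ⟪x + u x, u x⟫ = 0 := by rw [← hu, h1, h2]
    have h4 : x + u x = 0 := by
      rw [← inner_self_eq_zero (𝕜 := ℝ), inner_add_right, h2, h3, add_zero]
    exact (eq_neg_of_add_eq_zero_left h4).symm
  · intro h v hv
    have h1 : ⟪v, x⟫ = -⟪v, x⟫ := by
      conv_lhs => rw [← mem_fixedSpace.1 hv, hu, ← neg_neg (u x), h, inner_neg_right]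
    linarith

theorem half_add_mem_fixedSpace {u : E →L[ℝ] E} (huu : ∀ x, u (u x) = x) (x : E) :
    (1 / 2 : ℝ) • (x + u x) ∈ fixedSpace u := by
  rw [mem_fixedSpace, map_smul, map_add, huu, add_comm]

theorem finrank_fixedSpace [FiniteDimensional ℝ E] {u : E →L[ℝ] E} (huu : ∀ x, u (u x) = x)
    (htr : LinearMap.trace ℝ E u = 0) :
    (Module.finrank ℝ (fixedSpace u) : ℝ) = Module.finrank ℝ E / 2 := by
  have h : LinearMap.IsProj (fixedSpace u) ((1 / 2 : ℝ) • (LinearMap.id + (u : E →ₗ[ℝ] E))) :=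
    ⟨fun x => half_add_mem_fixedSpace huu x, fun x hx => by
      change (1 / 2 : ℝ) • (x + u x) = x
      rw [mem_fixedSpace.1 hx, ← two_smul ℝ x, smul_smul]
      norm_num⟩
  rw [← h.trace, map_smul, map_add, htr, LinearMap.trace_id, smul_eq_mul]
  ring

/-- A point of the section of a convex set by the fixed space of one operator is near the section
by the fixed space of a nearby involution. -/
theorem exists_mem_inter_fixedSpace_dist_le {C : Set E} (hC : Convex ℝ C) {ρ M e : ℝ}
    (hρ : 0 < ρ) (hball : Metric.closedBall 0 ρ ⊆ C) (he : 0 < e) {u v : E →L[ℝ] E}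
    (hvv : ∀ x, v (v x) = x) {x : E} (hx : x ∈ C ∩ fixedSpace u) (hM : ‖x‖ ≤ M)
    (hd : ‖v - u‖ * M ≤ e) : ∃ y ∈ C ∩ fixedSpace v, dist x y ≤ e * (1 + M / ρ) := by
  set w : E := (1 / 2 : ℝ) • (x + v x) - x with hw
  have hM0 : 0 ≤ M := (norm_nonneg x).trans hM
  have hwe : ‖w‖ ≤ e := by
    have h1 : w = (1 / 2 : ℝ) • (v - u) x := by
      rw [hw, _root_.sub_apply, mem_fixedSpace.1 hx.2]
      module
    rw [h1, norm_smul, Real.norm_of_nonneg (by norm_num)]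
    have h2 := ((v - u).le_opNorm x).trans (mul_le_mul_of_nonneg_left hM (norm_nonneg _))
    have h3 := norm_nonneg ((v - u) x)
    linarith
  have hpos : 0 < ρ + e := by positivity
  have hsum : ρ / (ρ + e) + e / (ρ + e) = 1 := by field_simp
  refine ⟨(ρ / (ρ + e)) • ((1 / 2 : ℝ) • (x + v x)), ⟨?_, ?_⟩, ?_⟩
  · have h1 : (ρ / e) • w ∈ C := hball (by
      rw [mem_closedBall_zero_iff, norm_smul, Real.norm_of_nonneg (by positivity),
        div_mul_eq_mul_div, div_le_iff₀ he]
      gcongr)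
    convert hC hx.1 h1 (by positivity : 0 ≤ ρ / (ρ + e)) (by positivity) hsum using 1
    rw [smul_smul _ _ w, show e / (ρ + e) * (ρ / e) = ρ / (ρ + e) by field_simp, ← smul_add, hw,
      add_sub_cancel]
  · exact (fixedSpace v).smul_mem _ (half_add_mem_fixedSpace hvv x)
  · have h1 : x - (ρ / (ρ + e)) • ((1 / 2 : ℝ) • (x + v x)) =
        (e / (ρ + e)) • x - (ρ / (ρ + e)) • w := by
      rw [hw, show e / (ρ + e) = 1 - ρ / (ρ + e) by linarith]
      module
    rw [dist_eq_norm, h1]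
    refine (norm_sub_le _ _).trans ?_
    rw [norm_smul, norm_smul, Real.norm_of_nonneg (by positivity),
      Real.norm_of_nonneg (by positivity)]
    have h2 : e / (ρ + e) * ‖x‖ ≤ e / ρ * M := by
      gcongr
      linarith
    have h3 : ρ / (ρ + e) * ‖w‖ ≤ 1 * e := by
      gcongr
      rw [div_le_one hpos]
      linarith
    calc _ ≤ e / ρ * M + 1 * e := add_le_add h2 h3
      _ = e * (1 + M / ρ) := by ring

end Reflection

theorem ConvexBody.continuous_interSubmodule_fixedSpace {d : ℕ}
    {C : ConvexBody (EuclideanSpace ℝ (Fin d))}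
    (hC : (0 : EuclideanSpace ℝ (Fin d)) ∈ interior (C : Set (EuclideanSpace ℝ (Fin d))))
    {X : Type*} [TopologicalSpace X]
    {u : X → EuclideanSpace ℝ (Fin d) →L[ℝ] EuclideanSpace ℝ (Fin d)} (hu : Continuous u)
    (huu : ∀ A x, u A (u A x) = x) :
    Continuous fun A => C.interSubmodule (fixedSpace (u A)) (interior_subset hC) := by
  obtain ⟨ρ, hρ, hball⟩ := Metric.nhds_basis_closedBall.mem_iff.1 (mem_interior_iff_mem_nhds.1 hC)
  obtain ⟨M, hM0, hM⟩ := C.isBounded.exists_pos_norm_le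
  rw [Metric.continuous_iff']
  intro A ε hε
  have hK : 0 < 1 + M / ρ := by positivity
  obtain ⟨e, he, hee⟩ : ∃ e > 0, e * (1 + M / ρ) < ε :=
    ⟨ε / 2 / (1 + M / ρ), by positivity, by rw [div_mul_cancel₀ _ hK.ne']; linarith⟩
  filter_upwards [Metric.continuous_iff'.1 hu A (e / M) (by positivity)] with B hB
  rw [dist_eq_norm, lt_div_iff₀ hM0] at hB
  rw [← ConvexBody.hausdorffDist_coe]
  refine (Metric.hausdorffDist_le_of_mem_dist (by positivity) ?_ ?_).trans_lt hee
  · exact fun x hx => exists_mem_inter_fixedSpace_dist_le C.convex hρ hball he (huu A) hx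
      (hM x hx.1) (by rw [norm_sub_rev]; exact hB.le)
  · exact fun x hx => exists_mem_inter_fixedSpace_dist_le C.convex hρ hball he (huu B) hx
      (hM x hx.1) hB.le

namespace SymmetricInvolution

variable {I : Type*} [Fintype I] [DecidableEq I]

/-- The reflection of Euclidean space given by a symmetric involutive matrix. -/
noncomputable def reflection (A : SymmetricInvolution I) :
    EuclideanSpace ℝ I →L[ℝ] EuclideanSpace ℝ I :=
  toEuclideanCLM (n := I) (𝕜 := ℝ) A.1

theorem reflection_neg (A : SymmetricInvolution I) : reflection (-A) = -reflection A :=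
  map_neg (toEuclideanCLM (n := I) (𝕜 := ℝ)) A.1

theorem continuous_reflection : Continuous (reflection (I := I)) := by
  have : Continuous (toEuclideanCLM (n := I) (𝕜 := ℝ)).toAlgEquiv.toLinearMap :=
    LinearMap.continuous_of_finiteDimensional _
  exact this.comp continuous_subtype_val

theorem reflection_reflection (A : SymmetricInvolution I) (x : EuclideanSpace ℝ I) :
    reflection A (reflection A x) = x := by
  rw [← mul_apply_eq_comp, reflection, ← map_mul, A.2.2, map_one,
    one_apply_eq_self]

open scoped RealInnerProductSpace in
theorem inner_reflection (A : SymmetricInvolution I) (x y : EuclideanSpace ℝ I) :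
    ⟪reflection A x, y⟫ = ⟪x, reflection A y⟫ := by
  have h : ContinuousLinearMap.adjoint (reflection A) = reflection A := by
    rw [← ContinuousLinearMap.star_eq_adjoint, reflection, ← map_star, star_eq_conjTranspose,
      conjTranspose_eq_transpose_of_trivial, A.2.1]
  conv_lhs => rw [← h]
  exact ContinuousLinearMap.adjoint_inner_left _ _ _

theorem trace_reflection (A : SymmetricInvolution I) :
    LinearMap.trace ℝ _ (reflection A : EuclideanSpace ℝ I →ₗ[ℝ] EuclideanSpace ℝ I) =
      A.1.trace := by
  rw [LinearMap.trace_eq_matrix_trace ℝ (EuclideanSpace.basisFun I ℝ).toBasis]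
  congr 1
  exact LinearMap.toMatrix_toLin _ _ A.1

theorem orthogonal_fixedSpace_reflection (A : SymmetricInvolution I) :
    (fixedSpace (reflection A))ᗮ = fixedSpace (reflection (-A)) := by
  rw [reflection_neg, orthogonal_fixedSpace (inner_reflection A) (reflection_reflection A)]

end SymmetricInvolution

/-- For `n = 2^a(2b+1)` and `k = 2^{a+1} − 1`, given `k` real-valued functions on convex
bodies of `ℝ^{2n}` continuous w.r.t. the Hausdorff metric, every convex body `C ⊆ ℝ^{2n}`
with the origin in its interior admits an `n`-dimensional subspace `V` such that each
function takes the same value on `C ∩ V` and on `C ∩ Vᗮ`. -/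
theorem orthogonal_sections (a b n k : ℕ) (hn : n = 2 ^ a * (2 * b + 1))
    (hk : k = 2 ^ (a + 1) - 1)
    (α : Fin k → ConvexBody (EuclideanSpace ℝ (Fin (2 * n))) → ℝ)
    (hα : ∀ i, Continuous (α i))
    (C : ConvexBody (EuclideanSpace ℝ (Fin (2 * n))))
    (hC : (0 : EuclideanSpace ℝ (Fin (2 * n))) ∈
      interior (C : Set (EuclideanSpace ℝ (Fin (2 * n))))) :
    ∃ V : Submodule ℝ (EuclideanSpace ℝ (Fin (2 * n))),
      Module.finrank ℝ V = n ∧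
      ∀ i : Fin k,
        α i (C.interSubmodule V (interior_subset hC)) =
          α i (C.interSubmodule Vᗮ (interior_subset hC)) := by
  have hcont : Continuous fun A : SymmetricInvolution (Fin (2 * n)) =>
      C.interSubmodule (fixedSpace (SymmetricInvolution.reflection A)) (interior_subset hC) :=
    ConvexBody.continuous_interSubmodule_fixedSpace hC
      SymmetricInvolution.continuous_reflection SymmetricInvolution.reflection_reflection
  have hneg : Continuous fun A : SymmetricInvolution (Fin (2 * n)) => -A :=
    Continuous.subtype_mk (continuous_subtype_val.neg) _
  obtain ⟨A, hA⟩ := SymmetricInvolution.exists_balanced_common_zero a (2 * b + 1) n k hn hk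
    (fun i A =>
      α i (C.interSubmodule (fixedSpace (SymmetricInvolution.reflection A.1))
        (interior_subset hC)) -
      α i (C.interSubmodule (fixedSpace (SymmetricInvolution.reflection (-A.1)))
        (interior_subset hC)))
    (fun i => .sub ((hα i).comp (hcont.comp continuous_subtype_val))
      ((hα i).comp (hcont.comp (hneg.comp continuous_subtype_val))))
    (fun i A => by
      change α i (C.interSubmodule (fixedSpace (SymmetricInvolution.reflection (-A.1))) _) -
        α i (C.interSubmodule (fixedSpace (SymmetricInvolution.reflection (-(-A.1)))) _) = _
      rw [show -(-A.1) = A.1 from Subtype.ext (neg_neg A.1.1), neg_sub])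
  refine ⟨fixedSpace (SymmetricInvolution.reflection A.1), ?_, fun i => ?_⟩
  · have h := finrank_fixedSpace (SymmetricInvolution.reflection_reflection A.1)
      ((SymmetricInvolution.trace_reflection A.1).trans A.2)
    rw [finrank_euclideanSpace_fin] at h
    push_cast at h
    rw [mul_div_cancel_left₀ _ two_ne_zero] at h
    exact_mod_cast h
  · rw [SymmetricInvolution.orthogonal_fixedSpace_reflection]
    exact sub_eq_zero.1 (hA i)
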